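/- Let K = 𝔽_q((u)) with its u-adic valuation topology. Then in each of the following cases there exist finite subgroups A₁, A₂ of SL₂(K) with the stated isomorphism types and intersection, such that the subgroup generated by A₁ ∪ A₂ is discrete and cocompact in SL₂(K): (i) q = 7: each A_i has order 48 with a unique element of order 2 and central quotient isomorphic to the symmetric group on 4 letters, and A₁ ∩ A₂ is cyclic of order 6; (ii) q = 11: each A_i ≅ SL₂(𝔽₃) and A₁ ∩ A₂ has order 2; (iii) q = 11: each A_i ≅ SL₂(𝔽₅) and A₁ ∩ A₂ is cyclic of order 10; (iv) q = 19: each A_i ≅ SL₂(𝔽₅) and A₁ ∩ A₂ is cyclic of order 6; (v) q = 23: each A_i has order 48 with a unique element of order 2 and central quotient isomorphic to the symmetric group on 4 letters, and A₁ ∩ A₂ has order 2; (vi) q = 59: each A_i ≅ SL₂(𝔽₅) and A₁ ∩ A₂ has order 2. -/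

import Mathlib

instance : Fact (Nat.Prime 7) := ⟨by norm_num⟩
instance : Fact (Nat.Prime 11) := ⟨by norm_num⟩
instance : Fact (Nat.Prime 19) := ⟨by norm_num⟩
instance : Fact (Nat.Prime 23) := ⟨by norm_num⟩
instance : Fact (Nat.Prime 59) := ⟨by norm_num⟩

/-- `SL₂` over a topological field carries the subspace topology induced from the
entrywise topology on `2 × 2` matrices. -/
noncomputable instance SL2.topologicalSpace (K : Type*) [Field K] [TopologicalSpace K] :
    TopologicalSpace (Matrix.SpecialLinearGroup (Fin 2) K) :=
  TopologicalSpace.induced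
    (fun g => (↑g : Matrix (Fin 2) (Fin 2) K)) inferInstance

/-- The pair `A₁, A₂` of finite subgroups of `SL₂(𝔽_q((u)))` generates a discrete
cocompact subgroup. -/
def GeneratesCocompactLattice (q : ℕ) [Fact q.Prime]
    (A₁ A₂ : Subgroup (Matrix.SpecialLinearGroup (Fin 2) (LaurentSeries (ZMod q)))) :
    Prop :=
  Finite A₁ ∧ Finite A₂ ∧
  DiscreteTopology (Subgroup.closure ((↑A₁ ∪ ↑A₂) :
    Set (Matrix.SpecialLinearGroup (Fin 2) (LaurentSeries (ZMod q))))) ∧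
  CompactSpace (Matrix.SpecialLinearGroup (Fin 2) (LaurentSeries (ZMod q)) ⧸
    Subgroup.closure ((↑A₁ ∪ ↑A₂) :
      Set (Matrix.SpecialLinearGroup (Fin 2) (LaurentSeries (ZMod q)))))

/-- `A` is a binary octahedral group `2S₄`: it has order `48`, a unique element of order
`2`, and central quotient isomorphic to the symmetric group on `4` letters. -/
def IsBinaryOctahedral {G : Type*} [Group G] (A : Subgroup G) : Prop :=
  Nat.card A = 48 ∧ (∃! x : A, orderOf x = 2) ∧
  Nonempty ((A ⧸ Subgroup.center A) ≃* Equiv.Perm (Fin 4))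

open Matrix LaurentSeries

local notation "SL₂" => Matrix.SpecialLinearGroup (Fin 2)

section Amalgam

variable {G : Type*} [Group G]

/-- `ReducedWord A i g` says that `g` is a product of factors taken alternately from the two
subgroups `A i` and `A !i`, none of them in the intersection, followed by an element of the
intersection. -/
inductive ReducedWord (A : Bool → Subgroup G) : Bool → G → Prop
  | base (i : Bool) (t : G) (ht : ∀ j, t ∈ A j) : ReducedWord A i t
  | step (i : Bool) (a g : G) (ha : a ∈ A i) (ha' : a ∉ A (!i)) (hg : ReducedWord A (!i) g) :
      ReducedWord A i (a * g)

theorem ReducedWord.inter_mul {A : Bool → Subgroup G} {i : Bool} {t g : G} (ht : ∀ j, t ∈ A j)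
    (hg : ReducedWord A i g) : ReducedWord A i (t * g) := by
  cases hg with
  | base _ _ h => exact .base _ _ fun j => (A j).mul_mem (ht j) (h j)
  | step _ a g ha ha' hg =>
    rw [← mul_assoc]
    exact .step _ _ _ ((A i).mul_mem (ht i) ha)
      (fun h => ha' (((A !i).mul_mem_cancel_left (ht _)).1 h)) hg

theorem ReducedWord.exists_mul {A : Bool → Subgroup G} {i j : Bool} {x g : G} (hx : x ∈ A i)
    (hg : ReducedWord A j g) : ∃ k, ReducedWord A k (x * g) := by
  by_cases hx' : x ∈ A (!i)
  · refine ⟨j, hg.inter_mul fun k => ?_⟩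
    rcases Bool.eq_or_eq_not k i with rfl | rfl <;> assumption
  rcases Bool.eq_or_eq_not j (!i) with rfl | rfl
  · exact ⟨i, .step _ _ _ hx hx' hg⟩
  rw [Bool.not_not] at hg
  cases hg with
  | base _ _ h =>
    refine ⟨i, .step _ _ _ hx hx' (.base _ _ h)⟩
  | step _ a g ha ha' hg =>
    rw [← mul_assoc]
    have hxa := (A i).mul_mem hx ha
    by_cases h : x * a ∈ A (!i)
    · refine ⟨!i, hg.inter_mul fun k => ?_⟩
      rcases Bool.eq_or_eq_not k i with rfl | rfl <;> assumption
    · exact ⟨i, .step _ _ _ hxa h hg⟩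

theorem exists_reducedWord_of_mem_closure {A : Bool → Subgroup G} {g : G}
    (hg : g ∈ Subgroup.closure ((A true : Set G) ∪ A false)) : ∃ i, ReducedWord A i g := by
  induction hg using Subgroup.closure_induction_left with
  | one => exact ⟨true, .base _ _ fun j => (A j).one_mem⟩
  | mul_left x hx y _ ih =>
    obtain ⟨i, hi⟩ := ih
    rcases hx with hx | hx <;> exact hi.exists_mul hx
  | inv_mul_cancel x hx y _ ih =>
    obtain ⟨i, hi⟩ := ih
    rcases hx with hx | hx
    · exact hi.exists_mul ((A true).inv_mem hx)
    · exact hi.exists_mul ((A false).inv_mem hx)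

end Amalgam

section Lattice

variable {F : Type*} [Field F]

/-- The inclusion of `SL₂(F)` into `SL₂(F((u)))` as constant matrices. -/
noncomputable def constSL : SL₂ F →* SL₂ F⸨X⸩ :=
  Matrix.SpecialLinearGroup.map HahnSeries.C

/-- The conjugate of a constant matrix by `diag(1, u)`. -/
noncomputable def twistMatrix (g : Matrix (Fin 2) (Fin 2) F) : Matrix (Fin 2) (Fin 2) F⸨X⸩ :=
  !![HahnSeries.single 0 (g 0 0), HahnSeries.single (-1) (g 0 1);
    HahnSeries.single 1 (g 1 0), HahnSeries.single 0 (g 1 1)]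

theorem det_twistMatrix (g : Matrix (Fin 2) (Fin 2) F) :
    (twistMatrix g).det = HahnSeries.C g.det := by
  simp [twistMatrix, det_fin_two, HahnSeries.C_apply]

theorem twistMatrix_mul (g h : Matrix (Fin 2) (Fin 2) F) :
    twistMatrix (g * h) = twistMatrix g * twistMatrix h := by
  ext i j : 2
  fin_cases i <;> fin_cases j <;> simp [twistMatrix, mul_apply, Fin.sum_univ_two]

/-- The conjugate of a constant matrix of determinant one by `diag(1, u)`. -/
noncomputable def twist (g : SL₂ F) : SL₂ F⸨X⸩ :=
  ⟨twistMatrix g, by rw [det_twistMatrix, g.det_coe, map_one]⟩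

theorem coe_twist (g : SL₂ F) : (twist g : Matrix (Fin 2) (Fin 2) F⸨X⸩) = twistMatrix g := rfl

/-- The inclusion of `SL₂(F)` into `SL₂(F((u)))` as constant matrices, conjugated by
`diag(1, u)`. -/
noncomputable def twistSL : SL₂ F →* SL₂ F⸨X⸩ :=
  MonoidHom.mk' twist fun g h => by
    apply Subtype.ext
    rw [Matrix.SpecialLinearGroup.coe_mul, coe_twist, coe_twist, coe_twist,
      Matrix.SpecialLinearGroup.coe_mul, twistMatrix_mul]

theorem constSL_apply (g : SL₂ F) (i j : Fin 2) :
    constSL g i j = HahnSeries.single 0 (g i j) := rfl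

theorem twistSL_apply (g : SL₂ F) :
    (twistSL g : Matrix (Fin 2) (Fin 2) F⸨X⸩) =
      !![HahnSeries.single 0 (g 0 0), HahnSeries.single (-1) (g 0 1);
        HahnSeries.single 1 (g 1 0), HahnSeries.single 0 (g 1 1)] := rfl

theorem constSL_injective : Function.Injective (constSL (F := F)) := fun g h e => by
  ext i j
  have := congrArg (fun x => (x i j : F⸨X⸩).coeff 0) e
  simpa [constSL_apply] using this

theorem twistSL_injective : Function.Injective (twistSL (F := F)) := fun g h e => by
  have (i j) (n : ℤ) := congrArg (fun x => (x i j : F⸨X⸩).coeff n) e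
  ext i j
  fin_cases i <;> fin_cases j
  · simpa [twistSL_apply] using this 0 0 0
  · simpa [twistSL_apply] using this 0 1 (-1)
  · simpa [twistSL_apply] using this 1 0 1
  · simpa [twistSL_apply] using this 1 1 0

theorem constSL_eq_twistSL {g : SL₂ F} (h₁ : g 0 1 = 0) (h₂ : g 1 0 = 0) :
    constSL g = twistSL g := by
  ext i j : 2
  fin_cases i <;> fin_cases j <;> simp [constSL_apply, twistSL_apply, h₁, h₂]

theorem eq_and_offDiag_eq_zero_of_constSL_eq_twistSL {g h : SL₂ F}
    (e : constSL g = twistSL h) : g = h ∧ g 0 1 = 0 ∧ g 1 0 = 0 := by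
  have (i j) (n : ℤ) := congrArg (fun x => (x i j : F⸨X⸩).coeff n) e
  have h00 : g 0 0 = h 0 0 := by simpa [constSL_apply, twistSL_apply] using this 0 0 0
  have h11 : g 1 1 = h 1 1 := by simpa [constSL_apply, twistSL_apply] using this 1 1 0
  have h01 : g 0 1 = 0 := by
    simpa [constSL_apply, twistSL_apply, HahnSeries.coeff_single] using this 0 1 0
  have h10 : g 1 0 = 0 := by
    simpa [constSL_apply, twistSL_apply, HahnSeries.coeff_single] using this 1 0 0
  have h01' : 0 = h 0 1 := by
    simpa [constSL_apply, twistSL_apply, HahnSeries.coeff_single] using this 0 1 (-1)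
  have h10' : 0 = h 1 0 := by
    simpa [constSL_apply, twistSL_apply, HahnSeries.coeff_single] using this 1 0 1
  refine ⟨?_, h01, h10⟩
  ext i j
  fin_cases i <;> fin_cases j <;> simp_all

/-- The line spanned by `(x, y)` is congruent to the first axis, and `x` has order `n`. -/
def IsHorizontal (n : ℤ) (x y : F⸨X⸩) : Prop :=
  x.coeff n ≠ 0 ∧ (∀ m < n, x.coeff m = 0) ∧ ∀ m ≤ n, y.coeff m = 0

/-- The line spanned by `(x, y)` is not congruent to the first axis, and `y` has order `n`. -/
def IsVertical (n : ℤ) (x y : F⸨X⸩) : Prop :=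
  y.coeff n ≠ 0 ∧ (∀ m < n, y.coeff m = 0) ∧ ∀ m < n, x.coeff m = 0

theorem coeff_constSL_mul (a : SL₂ F)
    (g : SL₂ F⸨X⸩) (i j : Fin 2) (n : ℤ) :
    ((constSL a * g) i j).coeff n = a i 0 * (g 0 j).coeff n + a i 1 * (g 1 j).coeff n := by
  simp [mul_apply, Fin.sum_univ_two, constSL_apply]

theorem coeff_twistSL_mul_zero (a : SL₂ F)
    (g : SL₂ F⸨X⸩) (j : Fin 2) (n : ℤ) :
    ((twistSL a * g) 0 j).coeff n = a 0 0 * (g 0 j).coeff n + a 0 1 * (g 1 j).coeff (n + 1) := by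
  simp [mul_apply, Fin.sum_univ_two, twistSL_apply, HahnSeries.coeff_single_mul]

theorem coeff_twistSL_mul_one (a : SL₂ F)
    (g : SL₂ F⸨X⸩) (j : Fin 2) (n : ℤ) :
    ((twistSL a * g) 1 j).coeff n = a 1 0 * (g 0 j).coeff (n - 1) + a 1 1 * (g 1 j).coeff n := by
  simp [mul_apply, Fin.sum_univ_two, twistSL_apply, HahnSeries.coeff_single_mul]

theorem IsHorizontal.constSL_mul {n : ℤ} {g : SL₂ F⸨X⸩} {j : Fin 2}
    (h : IsHorizontal n (g 0 j) (g 1 j)) {a : SL₂ F} (ha : a 1 0 ≠ 0) :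
    IsVertical n ((constSL a * g) 0 j) ((constSL a * g) 1 j) := by
  obtain ⟨h1, h2, h3⟩ := h
  refine ⟨?_, fun m hm => ?_, fun m hm => ?_⟩
  · simpa only [coeff_constSL_mul, h3 n le_rfl, mul_zero, add_zero] using mul_ne_zero ha h1
  · simp only [coeff_constSL_mul, h2 m hm, h3 m hm.le, mul_zero, add_zero]
  · simp only [coeff_constSL_mul, h2 m hm, h3 m hm.le, mul_zero, add_zero]

theorem IsVertical.twistSL_mul {n : ℤ} {g : SL₂ F⸨X⸩} {j : Fin 2}
    (h : IsVertical n (g 0 j) (g 1 j)) {a : SL₂ F} (ha : a 0 1 ≠ 0) :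
    IsHorizontal (n - 1) ((twistSL a * g) 0 j) ((twistSL a * g) 1 j) := by
  obtain ⟨h1, h2, h3⟩ := h
  refine ⟨?_, fun m hm => ?_, fun m hm => ?_⟩
  · simpa only [coeff_twistSL_mul_zero, h3 (n - 1) (by lia), mul_zero, zero_add,
      sub_add_cancel] using mul_ne_zero ha h1
  · simp only [coeff_twistSL_mul_zero, h3 m (by lia), h2 (m + 1) (by lia), mul_zero, add_zero]
  · simp only [coeff_twistSL_mul_one, h3 (m - 1) (by lia), h2 m (by lia), mul_zero, add_zero]

/-- The two vertex groups attached to a subgroup of `SL₂(F)`. -/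
noncomputable def vertexGroup (A : Subgroup (SL₂ F)) :
    Bool → Subgroup (SL₂ F⸨X⸩)
  | true => A.map constSL
  | false => A.map twistSL

variable {A : Subgroup (SL₂ F)}

theorem exists_of_mem_vertexGroup_inter {x : SL₂ F⸨X⸩}
    (hx : ∀ i, x ∈ vertexGroup A i) : ∃ a ∈ A, constSL a = x ∧ a 0 1 = 0 ∧ a 1 0 = 0 := by
  obtain ⟨a, ha, rfl⟩ := hx true
  obtain ⟨b, hb, e⟩ := hx false
  exact ⟨a, ha, rfl, (eq_and_offDiag_eq_zero_of_constSL_eq_twistSL e.symm).2⟩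

theorem reducedWord_vertexGroup (hA : ∀ a ∈ A, a 0 1 = 0 ↔ a 1 0 = 0) {i : Bool}
    {g : SL₂ F⸨X⸩} (hg : ReducedWord (vertexGroup A) i g) :
    g ∈ vertexGroup A true ∧ (i = false → g ∈ vertexGroup A false) ∨
      ∃ j, ∃ n < 0, bif i then IsVertical n (g 0 j) (g 1 j)
        else IsHorizontal n (g 0 j) (g 1 j) := by
  induction hg with
  | base i t ht => exact .inl ⟨ht _, fun _ => ht _⟩
  | step i x g hx hx' hg ih =>
    cases i with
    | true =>
      obtain ⟨a, ha, rfl⟩ := hx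
      have ha' : a 1 0 ≠ 0 := fun h =>
        hx' ⟨a, ha, (constSL_eq_twistSL ((hA a ha).2 h) h).symm⟩
      rcases ih with ih | ⟨j, n, hn, ih⟩
      · exact .inl ⟨Subgroup.mul_mem _ ⟨a, ha, rfl⟩ ih.1, by simp⟩
      · exact .inr ⟨j, n, hn, IsHorizontal.constSL_mul ih ha'⟩
    | false =>
      right
      obtain ⟨a, ha, rfl⟩ := hx
      have ha' : a 0 1 ≠ 0 := fun h =>
        hx' ⟨a, ha, constSL_eq_twistSL h ((hA a ha).1 h)⟩
      rcases ih with ⟨⟨b, hb, rfl⟩, -⟩ | ⟨j, n, hn, ih⟩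
      · obtain ⟨j, hj⟩ : ∃ j, b 1 j ≠ 0 := by
          by_contra! h
          have hb := b.det_coe
          rw [det_fin_two, h, h] at hb
          simp at hb
        refine ⟨j, 0 - 1, by simp, IsVertical.twistSL_mul ⟨?_, fun m hm => ?_, fun m hm => ?_⟩ ha'⟩
        · simpa [constSL_apply] using hj
        · simp [constSL_apply, hm.ne]
        · simp [constSL_apply, hm.ne]
      · exact ⟨j, n - 1, by lia, IsVertical.twistSL_mul ih ha'⟩

/-- Matrices all of whose entries are power series. -/
def integralSL (F : Type*) [Field F] : Set (SL₂ F⸨X⸩) :=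
  {g | ∀ i j, ∀ n < 0, (g i j).coeff n = 0}

theorem mem_vertexGroup_of_mem_closure_of_integral (hA : ∀ a ∈ A, a 0 1 = 0 ↔ a 1 0 = 0)
    {g : SL₂ F⸨X⸩}
    (hg : g ∈ Subgroup.closure ((vertexGroup A true : Set _) ∪ vertexGroup A false))
    (hg' : g ∈ integralSL F) : g ∈ vertexGroup A true := by
  obtain ⟨i, hi⟩ := exists_reducedWord_of_mem_closure hg
  rcases reducedWord_vertexGroup hA hi with h | ⟨j, n, hn, h⟩
  · exact h.1
  · cases i
    · exact (h.1 (hg' _ _ _ hn)).elim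
    · exact (h.1 (hg' _ _ _ hn)).elim

/-- Every singular `2 × 2` matrix is annihilated by the row of an element of `A`, as soon as
`A` moves every line to an axis. -/
theorem exists_row_annihilating {A : Subgroup (SL₂ F)} {i : Fin 2}
    (hA : ∀ x y : F, ∃ a ∈ A, a i 0 * x + a i 1 * y = 0) {p q r s : F} (h : p * s - q * r = 0) :
    ∃ a ∈ A, a i 0 * p + a i 1 * r = 0 ∧ a i 0 * q + a i 1 * s = 0 := by
  by_cases hpr : p = 0 ∧ r = 0
  · obtain ⟨a, ha, e⟩ := hA q s
    exact ⟨a, ha, by simp [hpr], e⟩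
  · obtain ⟨a, ha, e⟩ := hA p r
    refine ⟨a, ha, e, ?_⟩
    by_cases hp : p = 0
    · have hr : r ≠ 0 := fun hr => hpr ⟨hp, hr⟩
      apply mul_left_cancel₀ hr
      linear_combination s * e - a i 0 * h
    · apply mul_left_cancel₀ hp
      linear_combination q * e + a i 1 * h

/-- The lowest coefficient of the determinant. -/
theorem coeff_mul_of_bounded {x y : F⸨X⸩} {m n : ℤ} (hx : ∀ k < m, x.coeff k = 0)
    (hy : ∀ k < n, y.coeff k = 0) : (x * y).coeff (m + n) = x.coeff m * y.coeff n := by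
  rw [HahnSeries.coeff_mul]
  have hsub : Finset.antidiagonal x.isPWO_support y.isPWO_support (m + n) ⊆ {(m, n)} := by
    intro ij hij
    rw [Finset.mem_antidiagonal] at hij
    obtain ⟨h1, h2, h3⟩ := hij
    have h1' : m ≤ ij.1 := not_lt.1 fun h => h1 (hx _ h)
    have h2' : n ≤ ij.2 := not_lt.1 fun h => h2 (hy _ h)
    rw [Finset.mem_singleton]
    ext <;> simp <;> lia
  rw [Finset.sum_subset hsub, Finset.sum_singleton]
  intro ij hij hij'
  rw [Finset.mem_singleton] at hij
  subst hij
  by_contra h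
  exact hij' (Finset.mem_antidiagonal.2 ⟨left_ne_zero_of_mul h, right_ne_zero_of_mul h, rfl⟩)

theorem exists_mul_mem_integralSL (hA : ∀ x y : F, ∀ i : Fin 2, ∃ a ∈ A, a i 0 * x + a i 1 * y = 0)
    (k : ℕ) : ∀ g : SL₂ F⸨X⸩, (∀ i j, ∀ n < -(k : ℤ), (g i j).coeff n = 0) →
      ∃ γ ∈ Subgroup.closure ((vertexGroup A true : Set _) ∪ vertexGroup A false),
        γ * g ∈ integralSL F := by
  induction k with
  | zero => exact fun g hg => ⟨1, one_mem _, by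
    rw [one_mul]
    exact fun i j n hn => hg i j n (by simpa using hn)⟩
  | succ k ih =>
    intro g hg
    push_cast at hg
    have hdet : ∀ g : SL₂ F⸨X⸩, ∀ n < 0,
        (g 0 0 * g 1 1).coeff n - (g 0 1 * g 1 0).coeff n = 0 := by
      intro g n hn
      have h := g.det_coe
      rw [det_fin_two] at h
      rw [← HahnSeries.coeff_sub, h, HahnSeries.coeff_one, if_neg hn.ne]
    obtain ⟨a, ha, h1, h2⟩ := exists_row_annihilating (fun x y => hA x y 1)
      (p := (g 0 0).coeff (-(k + 1))) (q := (g 0 1).coeff (-(k + 1)))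
      (r := (g 1 0).coeff (-(k + 1))) (s := (g 1 1).coeff (-(k + 1))) (by
        rw [← coeff_mul_of_bounded (hg 0 0) (hg 1 1), ← coeff_mul_of_bounded (hg 0 1) (hg 1 0)]
        exact hdet g _ (by lia))
    have hg' : ∀ i j, ∀ n < -(k + 1 : ℤ), ((constSL a * g) i j).coeff n = 0 := by
      intro i j n hn
      simp only [coeff_constSL_mul, hg _ _ _ hn, mul_zero, add_zero]
    have hg1 : ∀ j, ∀ n < -(k : ℤ), ((constSL a * g) 1 j).coeff n = 0 := by
      intro j n hn
      rcases (show n < -(k + 1 : ℤ) ∨ n = -(k + 1 : ℤ) by lia) with hn | rfl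
      · exact hg' _ _ _ hn
      · rw [coeff_constSL_mul]
        fin_cases j
        · exact h1
        · exact h2
    have haΓ : constSL a ∈ Subgroup.closure ((vertexGroup A true : Set _) ∪ vertexGroup A false) :=
      Subgroup.subset_closure (.inl ⟨a, ha, rfl⟩)
    obtain ⟨b, hb, h3, h4⟩ := exists_row_annihilating (fun x y => hA x y 0)
      (p := ((constSL a * g) 0 0).coeff (-(k + 1))) (q := ((constSL a * g) 0 1).coeff (-(k + 1)))
      (r := ((constSL a * g) 1 0).coeff (-k)) (s := ((constSL a * g) 1 1).coeff (-k)) (by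
        rw [← coeff_mul_of_bounded (hg' 0 0) (hg1 1), ← coeff_mul_of_bounded (hg' 0 1) (hg1 0)]
        exact hdet _ _ (by lia))
    have hbΓ : twistSL b ∈ Subgroup.closure ((vertexGroup A true : Set _) ∪ vertexGroup A false) :=
      Subgroup.subset_closure (.inr ⟨b, hb, rfl⟩)
    obtain ⟨γ, hγ, h⟩ := ih (twistSL b * (constSL a * g)) (by
      intro i j n hn
      fin_cases i
      · rw [Fin.zero_eta, coeff_twistSL_mul_zero]
        rcases (show n < -(k + 1 : ℤ) ∨ n = -(k + 1 : ℤ) by lia) with hn | rfl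
        · rw [hg' _ _ _ hn, hg1 _ _ (by lia), mul_zero, mul_zero, add_zero]
        · rw [show -(k + 1 : ℤ) + 1 = -k by ring]
          fin_cases j
          · exact h3
          · exact h4
      · rw [Fin.mk_one, coeff_twistSL_mul_one, hg' _ _ _ (by lia), hg1 _ _ hn, mul_zero, mul_zero,
          add_zero])
    exact ⟨γ * twistSL b * constSL a, mul_mem (mul_mem hγ hbΓ) haΓ, by simpa only [mul_assoc]⟩

end Lattice

section Topology

open Filter Topology WithZero MonoidWithZeroHom.ValueGroup₀

variable {F : Type*} [Field F]

lemma isOpen_setOf_coeff_eq_zero :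
    IsOpen {f : F⸨X⸩ | ∀ n < 0, f.coeff n = 0} := by
  convert Valued.isOpen_integer F⸨X⸩ using 1
  ext f
  have h := LaurentSeries.valuation_le_iff_coeff_lt_eq_zero F (D := 0) (f := f)
  rw [neg_zero, exp_zero] at h
  exact h.symm

lemma continuous_ofPowerSeries_mk [TopologicalSpace F] [DiscreteTopology F] :
    Continuous fun s : ℕ → F => HahnSeries.ofPowerSeries ℤ F (PowerSeries.mk s) := by
  refine continuous_iff_continuousAt.2 fun s U hU => ?_
  obtain ⟨γ, hγ⟩ := Valued.mem_nhds.mp hU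
  obtain ⟨D, hD⟩ : ∃ D : ℕ, exp (-(D : ℤ)) < embedding γ.1 := by
    refine ⟨(-(log (embedding γ.1) - 1)).toNat, ?_⟩
    rw [← lt_log_iff_exp_lt (by simp)]
    lia
  have hs : ∀ᶠ t in 𝓝 s, ∀ n ∈ Finset.range D, t n = s n := by
    refine (Finset.eventually_all _).2 fun n _ => ?_
    exact (continuous_apply n).continuousAt.eventually (by simp : ∀ᶠ x in 𝓝 (s n), x = s n)
  refine hs.mono fun t ht => hγ ?_
  simp only [Set.mem_ofPred_eq, Valued.v.restrict_lt_iff_lt_embedding]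
  refine lt_of_le_of_lt ((LaurentSeries.valuation_le_iff_coeff_lt_eq_zero F).2 fun n hn => ?_) hD
  rcases lt_or_ge n 0 with h | h
  · simp [HahnSeries.coeff_sub, PowerSeries.coeff_coe, h]
  · lift n to ℕ using h
    have := ht n (by simpa using hn)
    simp [HahnSeries.coeff_sub, this]

lemma isCompact_setOf_coeff_eq_zero [Finite F] :
    IsCompact {f : F⸨X⸩ | ∀ n < 0, f.coeff n = 0} := by
  let _ : TopologicalSpace F := ⊥
  have _ : DiscreteTopology F := ⟨rfl⟩
  convert isCompact_range (continuous_ofPowerSeries_mk (F := F)) using 1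
  ext f
  have h := LaurentSeries.valuation_le_iff_coeff_lt_eq_zero F (D := 0) (f := f)
  rw [neg_zero, exp_zero, LaurentSeries.val_le_one_iff_eq_coe] at h
  refine h.symm.trans ⟨?_, ?_⟩
  · rintro ⟨P, rfl⟩
    exact ⟨fun n => P.coeff n, congrArg _ (by ext; simp)⟩
  · rintro ⟨s, rfl⟩
    exact ⟨_, rfl⟩

instance [TopologicalSpace F] [IsTopologicalRing F] : IsTopologicalGroup (SL₂ F) :=
  Matrix.SpecialLinearGroup.topologicalGroup

instance [TopologicalSpace F] [IsTopologicalRing F] [T1Space F] : T1Space (SL₂ F) :=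
  Matrix.SpecialLinearGroup.instT1Space

lemma isClosedEmbedding_coe [TopologicalSpace F] [IsTopologicalRing F] [T1Space F] :
    IsClosedEmbedding fun g : SL₂ F => (g : Matrix (Fin 2) (Fin 2) F) :=
  Matrix.SpecialLinearGroup.isClosedEmbedding_val

lemma isOpen_integralSL : IsOpen (integralSL F) := by
  have h : integralSL F = ⋂ i, ⋂ j, {g | ∀ n < 0, (g i j).coeff n = 0} := by
    ext g
    simp only [integralSL, Set.mem_iInter, Set.mem_ofPred_eq]
  rw [h]
  refine isOpen_iInter_of_finite fun i => isOpen_iInter_of_finite fun j => ?_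
  have : Continuous fun g : SL₂ F⸨X⸩ => g i j :=
    (isClosedEmbedding_coe.continuous.matrix_elem i j)
  exact isOpen_setOf_coeff_eq_zero.preimage this

lemma isCompact_integralSL [Finite F] : IsCompact (integralSL F) := by
  have h : IsCompact (Set.pi Set.univ fun _ : Fin 2 => Set.pi Set.univ fun _ : Fin 2 =>
      {f : F⸨X⸩ | ∀ n < 0, f.coeff n = 0}) :=
    isCompact_univ_pi fun _ => isCompact_univ_pi fun _ => isCompact_setOf_coeff_eq_zero
  convert (isClosedEmbedding_coe (F := F⸨X⸩)).isCompact_preimage h using 1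
  ext g
  exact ⟨fun hg i _ j _ => hg i j, fun hg i j => hg i trivial j trivial⟩

end Topology

section Main

variable {q : ℕ} [Fact q.Prime] {A : Subgroup (SL₂ (ZMod q))}

instance (i : Bool) : Finite (vertexGroup A i) := by
  cases i
  · exact (Set.toFinite (A : Set (SL₂ (ZMod q)))).image twistSL
  · exact (Set.toFinite (A : Set (SL₂ (ZMod q)))).image constSL

lemma exists_coeff_eq_zero {F : Type*} [Field F] (g : SL₂ F⸨X⸩) :
    ∃ k : ℕ, ∀ i j, ∀ n < -(k : ℤ), (g i j).coeff n = 0 := by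
  refine ⟨∑ i, ∑ j, (g i j).order.natAbs, fun i j n hn => HahnSeries.coeff_eq_zero_of_lt_order ?_⟩
  have h₁ := Finset.single_le_sum (f := fun j => (g i j).order.natAbs) (fun _ _ => Nat.zero_le _)
    (Finset.mem_univ j)
  have h₂ := Finset.single_le_sum (f := fun i => ∑ j, (g i j).order.natAbs)
    (fun _ _ => Nat.zero_le _) (Finset.mem_univ i)
  have h₃ := h₁.trans h₂
  lia

lemma generatesCocompactLattice_vertexGroup (hA : ∀ a ∈ A, a 0 1 = 0 ↔ a 1 0 = 0)
    (hA' : ∀ x y : ZMod q, ∀ i : Fin 2, ∃ a ∈ A, a i 0 * x + a i 1 * y = 0) :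
    GeneratesCocompactLattice q (vertexGroup A true) (vertexGroup A false) := by
  refine ⟨inferInstance, inferInstance, ?_, ?_⟩
  · refine discreteTopology_of_isOpen_singleton_one ?_
    set Γ := Subgroup.closure ((vertexGroup A true : Set (SL₂ (ZMod q)⸨X⸩)) ∪ vertexGroup A false)
    have hfin : ((↑) ⁻¹' integralSL (ZMod q) : Set Γ).Finite := by
      refine (Set.Finite.preimage (Subtype.val_injective.injOn)
        (Set.finite_coe_iff.1 (inferInstance : Finite (vertexGroup A true)))).subset fun g hg => ?_
      exact mem_vertexGroup_of_mem_closure_of_integral hA g.2 hg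
    have hopen : IsOpen ((↑) ⁻¹' integralSL (ZMod q) : Set Γ) :=
      isOpen_integralSL.preimage continuous_subtype_val
    convert hopen.inter (hfin.subset (Set.sdiff_subset (t := {1}))).isClosed.isOpen_compl
    refine Set.eq_of_subset_of_subset ?_ ?_
    · rintro _ rfl
      refine ⟨fun i j n hn => ?_, by simp⟩
      fin_cases i <;> fin_cases j <;> simp [HahnSeries.coeff_one, hn.ne]
    · rintro g ⟨hg, hg'⟩
      by_contra h
      exact hg' ⟨hg, h⟩
  · set Γ := Subgroup.closure ((vertexGroup A true : Set (SL₂ (ZMod q)⸨X⸩)) ∪ vertexGroup A false)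
    refine ⟨?_⟩
    have := (isCompact_integralSL (F := ZMod q)).image
      (QuotientGroup.continuous_mk.comp continuous_inv :
        Continuous fun g => ((g⁻¹ : SL₂ _) : _ ⧸ Γ))
    convert this using 1
    refine (Set.eq_univ_of_forall fun x => ?_).symm
    induction x using QuotientGroup.induction_on with | H g => ?_
    obtain ⟨k, hk⟩ := exists_coeff_eq_zero g⁻¹
    obtain ⟨γ, hγ, hγ'⟩ := exists_mul_mem_integralSL hA' k g⁻¹ hk
    refine ⟨_, hγ', QuotientGroup.eq.2 ?_⟩
    simpa using hγ

end Main

section Counting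

open MulAction LinearAlgebra.Projectivization

variable {F : Type*} [Field F]

/-- The point of the projective line spanned by a standard basis vector. -/
def axis (F : Type*) [Field F] (i : Fin 2) : ℙ F (Fin 2 → F) :=
  Projectivization.mk F (Pi.single i 1) (by simp)

lemma smul_eq_axis_iff {a : SL₂ F} {v : Fin 2 → F} (hv : v ≠ 0) {i : Fin 2} :
    a • Projectivization.mk F v hv = axis F (i + 1) ↔ a i 0 * v 0 + a i 1 * v 1 = 0 := by
  rw [Projectivization.smul_mk, axis, Projectivization.mk_eq_mk_iff']
  have key (k : Fin 2) : (a • v) k = a k 0 * v 0 + a k 1 * v 1 := by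
    simp [Matrix.SpecialLinearGroup.smul_def, Matrix.mulVec, dotProduct, Fin.sum_univ_two]
  rw [← key]
  constructor
  · rintro ⟨c, hc⟩
    rw [← hc]
    fin_cases i <;> simp
  · refine fun h => ⟨(a • v) (i + 1), ?_⟩
    ext k
    fin_cases i <;> fin_cases k <;> simp_all

lemma mem_stabilizer_axis_iff {a : SL₂ F} {i : Fin 2} :
    a ∈ stabilizer (SL₂ F) (axis F (i + 1)) ↔ a i (i + 1) = 0 := by
  rw [mem_stabilizer_iff]
  refine (smul_eq_axis_iff (v := Pi.single (i + 1) 1) (by simp)).trans ?_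
  fin_cases i <;> simp

/-- The diagonal entry, as a character of the stabilizer of an axis. -/
def diagonalEntry (F : Type*) [Field F] (i : Fin 2) : stabilizer (SL₂ F) (axis F (i + 1)) →* F where
  toFun a := a.1 i i
  map_one' := by simp
  map_mul' a b := by
    have ha := mem_stabilizer_axis_iff.1 a.2
    fin_cases i <;> simp_all [Matrix.mul_apply, Fin.sum_univ_two]

lemma eq_one_of_pow_eq_one {a : SL₂ F} {i : Fin 2} {n : ℕ} (h₀ : a i (i + 1) = 0)
    (h₁ : a i i = 1) (hn : (n : F) ≠ 0) (ha : a ^ n = 1) : a = 1 := by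
  have hdet := a.det_coe
  rw [Matrix.det_fin_two] at hdet
  have h₂ : a (i + 1) (i + 1) = 1 := by fin_cases i <;> simp_all
  have hpow (k : ℕ) : (a ^ k) i i = 1 ∧ (a ^ k) i (i + 1) = 0 ∧ (a ^ k) (i + 1) (i + 1) = 1 ∧
      (a ^ k) (i + 1) i = k * a (i + 1) i := by
    induction k with
    | zero => fin_cases i <;> simp
    | succ k ih =>
      rw [pow_succ, Matrix.SpecialLinearGroup.coe_mul]
      fin_cases i <;> simp_all [Matrix.mul_apply, Fin.sum_univ_two, add_mul, add_comm]
  have h₃ : a (i + 1) i = 0 := by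
    have := (hpow n).2.2.2
    rw [ha] at this
    have h : ((1 : SL₂ F) : Matrix (Fin 2) (Fin 2) F) (i + 1) i = 0 := by fin_cases i <;> simp
    rw [h] at this
    exact (mul_eq_zero.1 this.symm).resolve_left hn
  ext j k
  fin_cases i <;> fin_cases j <;> fin_cases k <;> simp_all

variable {A : Subgroup (SL₂ F)} {d : SL₂ F}

lemma card_stabilizer_axis_dvd (hA : (Nat.card A : F) ≠ 0) (i : Fin 2) :
    Nat.card (stabilizer A (axis F (i + 1))) ∣ (Nat.card A).gcd (Nat.card F - 1) := by
  refine Nat.dvd_gcd (Subgroup.card_subgroup_dvd_card _) ?_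
  let f : stabilizer A (axis F (i + 1)) →* Fˣ :=
    ((diagonalEntry F i).comp (A.subtype.subgroupComap (stabilizer (SL₂ F) _))).toHomUnits
  have hf : Function.Injective f := by
    refine (injective_iff_map_eq_one f).2 fun a ha => ?_
    have := eq_one_of_pow_eq_one (mem_stabilizer_axis_iff.1 a.2) (congrArg Units.val ha) hA
      (congrArg Subtype.val (pow_card_eq_one' (x := a.1)))
    exact Subtype.ext (Subtype.ext this)
  rw [← Nat.card_units]
  exact Subgroup.card_dvd_of_injective f hf

variable (hA : (Nat.card A : F) ≠ 0) (hd : d ∈ A) (h01 : d 0 1 = 0) (h10 : d 1 0 = 0)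
  (hord : orderOf d = (Nat.card A).gcd (Nat.card F - 1))

include hA hd h01 h10 hord

lemma stabilizer_axis_eq_zpowers [Finite F] (i : Fin 2) :
    stabilizer A (axis F (i + 1)) = Subgroup.zpowers ⟨d, hd⟩ := by
  refine (Subgroup.eq_of_le_of_card_ge ?_ ?_).symm
  · rw [Subgroup.zpowers_le]
    refine mem_stabilizer_axis_iff.2 ?_
    fin_cases i <;> assumption
  · rw [Nat.card_zpowers, Subgroup.orderOf_mk, hord]
    exact Nat.le_of_dvd (Nat.gcd_pos_of_pos_left _ Nat.card_pos) (card_stabilizer_axis_dvd hA i)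

lemma mem_zpowers_of_eq_zero [Finite F] {a : SL₂ F} (ha : a ∈ A) (i : Fin 2) (h : a i (i + 1) = 0) :
    a ∈ Subgroup.zpowers d := by
  have : (⟨a, ha⟩ : A) ∈ stabilizer A (axis F (i + 1)) := mem_stabilizer_axis_iff.2 h
  rw [stabilizer_axis_eq_zpowers hA hd h01 h10 hord] at this
  obtain ⟨n, hn⟩ := this
  exact ⟨n, congrArg Subtype.val hn⟩

lemma mem_zpowers_iff_eq_zero [Finite F] {a : SL₂ F} (ha : a ∈ A) (i : Fin 2) :
    a ∈ Subgroup.zpowers d ↔ a i (i + 1) = 0 := by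
  refine ⟨fun h => mem_stabilizer_axis_iff.1 ?_, mem_zpowers_of_eq_zero hA hd h01 h10 hord ha i⟩
  refine (Subgroup.zpowers_le.2 <| mem_stabilizer_axis_iff.2 ?_) h
  fin_cases i <;> assumption

lemma exists_smul_eq_axis [Finite F] (hcard : Nat.card A = (Nat.card F + 1) * orderOf d) (i : Fin 2)
    (x : ℙ F (Fin 2 → F)) : ∃ a : A, a • x = axis F (i + 1) := by
  classical
  have : Finite (ℙ F (Fin 2 → F)) := inferInstance
  cases nonempty_fintype A
  cases nonempty_fintype (ℙ F (Fin 2 → F))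
  have h := card_orbit_mul_card_stabilizer_eq_card_group A (axis F (i + 1))
  rw [← Nat.card_eq_fintype_card, ← Nat.card_eq_fintype_card, ← Nat.card_eq_fintype_card,
    stabilizer_axis_eq_zpowers hA hd h01 h10 hord, Nat.card_zpowers, Subgroup.orderOf_mk,
    hcard] at h
  have h' := Nat.eq_of_mul_eq_mul_right (orderOf_pos d) h
  rw [← Projectivization.card_of_finrank_two F (Fin 2 → F) (by simp)] at h'
  have h'' : orbit A (axis F (i + 1)) = Set.univ :=
    Set.eq_of_subset_of_ncard_le (Set.subset_univ _) (by rw [Set.ncard_univ, ← h']; rfl)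
  have hx : x ∈ orbit A (axis F (i + 1)) := h'' ▸ Set.mem_univ x
  exact mem_orbit_symm.1 hx

end Counting

/-- A subgroup of `SL₂(𝔽_q)` acting transitively on the projective line, with diagonal cyclic
stabilizers, yields two vertex groups generating a cocompact lattice. -/
theorem exists_generatesCocompactLattice {q : ℕ} [Fact q.Prime] (A : Subgroup (SL₂ (ZMod q)))
    {d : SL₂ (ZMod q)} (hd : d ∈ A) (h01 : d 0 1 = 0) (h10 : d 1 0 = 0) {m : ℕ}
    (hord : orderOf d = m) (hcard : Nat.card A = (q + 1) * m)
    (hgcd : ((q + 1) * m).gcd (q - 1) = m) (hq : ((q + 1) * m).Coprime q) :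
    ∃ A₁ A₂ : Subgroup (SL₂ (ZMod q)⸨X⸩), Nonempty (A ≃* A₁) ∧ Nonempty (A ≃* A₂) ∧
      IsCyclic ↥(A₁ ⊓ A₂) ∧ Nat.card ↥(A₁ ⊓ A₂) = m ∧ GeneratesCocompactLattice q A₁ A₂ := by
  have hA : (Nat.card A : ZMod q) ≠ 0 := by
    rw [hcard, Ne, ZMod.natCast_eq_zero_iff]
    exact ((Fact.out : q.Prime).coprime_iff_not_dvd).1 hq.symm
  have hord' : orderOf d = (Nat.card A).gcd (Nat.card (ZMod q) - 1) := by
    rw [hcard, Nat.card_zmod, hgcd, hord]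
  have hinter : vertexGroup A true ⊓ vertexGroup A false = Subgroup.zpowers (constSL d) := by
    refine le_antisymm (fun x hx => ?_) ?_
    · obtain ⟨a, ha, rfl, ha', -⟩ :=
        exists_of_mem_vertexGroup_inter (Bool.forall_bool.2 ⟨hx.2, hx.1⟩)
      obtain ⟨n, rfl⟩ := mem_zpowers_of_eq_zero hA hd h01 h10 hord' ha 0 ha'
      exact ⟨n, (map_zpow _ _ _).symm⟩
    · rw [Subgroup.zpowers_le]
      exact ⟨⟨d, hd, rfl⟩, ⟨d, hd, (constSL_eq_twistSL h01 h10).symm⟩⟩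
  refine ⟨vertexGroup A true, vertexGroup A false, ⟨A.equivMapOfInjective _ constSL_injective⟩,
    ⟨A.equivMapOfInjective _ twistSL_injective⟩, ?_, ?_, ?_⟩
  · rw [hinter]
    infer_instance
  · rw [hinter, Nat.card_zpowers, orderOf_injective _ constSL_injective, hord]
  · refine generatesCocompactLattice_vertexGroup (fun a ha => ?_) fun x y i => ?_
    · exact (mem_zpowers_iff_eq_zero hA hd h01 h10 hord' ha 0).symm.trans
        (mem_zpowers_iff_eq_zero hA hd h01 h10 hord' ha 1)
    · by_cases hv : ![x, y] = 0
      · have hx := congrFun hv 0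
        have hy := congrFun hv 1
        exact ⟨1, one_mem _, by simp_all⟩
      · obtain ⟨a, ha⟩ := exists_smul_eq_axis hA hd h01 h10 hord'
          (by rw [hcard, Nat.card_zmod, hord]) i (Projectivization.mk _ _ hv)
        exact ⟨a, a.2, (smul_eq_axis_iff hv).1 ha⟩

section Bruhat

variable {p q : ℕ}

/-- The map sending a matrix with rows `(a, b)`, `(c, d)` to its Bruhat factorization with the
upper unipotent factors, the diagonal factors and the Weyl element replaced by `P`, `H` and `s`. -/
def bruhatMap (P H : ZMod p → Matrix (Fin 2) (Fin 2) (ZMod q)) (s : Matrix (Fin 2) (Fin 2) (ZMod q))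
    (a b c d : ZMod p) : Matrix (Fin 2) (Fin 2) (ZMod q) :=
  if c = 0 then H a * P (b * a ^ (p - 2))
  else P (a * c ^ (p - 2)) * (s * (H c * P (d * c ^ (p - 2))))

/-- The compatibilities needed for `bruhatMap P H s` to be an injective homomorphism on
`SL₂(𝔽_p)`. -/
def IsBruhatDatum (P H : ZMod p → Matrix (Fin 2) (Fin 2) (ZMod q))
    (s : Matrix (Fin 2) (Fin 2) (ZMod q)) : Prop :=
  bruhatMap P H s 1 0 0 1 = 1 ∧ ∀ a b c d : ZMod p, a * d - b * c = 1 →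
    bruhatMap P H s (a + c) (b + d) c d = P 1 * bruhatMap P H s a b c d ∧
    bruhatMap P H s (-c) (-d) a b = s * bruhatMap P H s a b c d ∧
    (bruhatMap P H s a b c d).det = 1 ∧
    (bruhatMap P H s a b c d = 1 → a = 1 ∧ b = 0 ∧ c = 0 ∧ d = 1)

set_option synthInstance.maxSize 1000 in
instance [NeZero p] (P H : ZMod p → Matrix (Fin 2) (Fin 2) (ZMod q))
    (s : Matrix (Fin 2) (Fin 2) (ZMod q)) : Decidable (IsBruhatDatum P H s) := by
  unfold IsBruhatDatum
  infer_instance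

/-- The element of `SL₂` with the given entries. -/
def sl₂ {R : Type*} [CommRing R] (a b c d : R) (h : a * d - b * c = 1) : SL₂ R :=
  ⟨!![a, b; c, d], by rwa [Matrix.det_fin_two_of]⟩

lemma eq_sl₂ {R : Type*} [CommRing R] (g : SL₂ R) :
    ∃ a b c d, ∃ h : a * d - b * c = 1, g = sl₂ a b c d h :=
  ⟨g 0 0, g 0 1, g 1 0, g 1 1, by rw [← Matrix.det_fin_two, g.det_coe],
    Subtype.ext (Matrix.eta_fin_two _)⟩

lemma sl₂_mul_sl₂ {R : Type*} [CommRing R] {a b c d a' b' c' d' : R} (h : a * d - b * c = 1)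
    (h' : a' * d' - b' * c' = 1) :
    sl₂ a b c d h * sl₂ a' b' c' d' h' = sl₂ (a * a' + b * c') (a * b' + b * d')
      (c * a' + d * c') (c * b' + d * d') (by linear_combination (a' * d' - b' * c') * h + h') :=
  Subtype.ext (Matrix.mul_fin_two _ _ _ _ _ _ _ _)

lemma sl₂_congr {R : Type*} [CommRing R] {a b c d a' b' c' d' : R} {h : a * d - b * c = 1}
    (ha : a = a') (hb : b = b') (hc : c = c') (hd : d = d') :
    sl₂ a b c d h = sl₂ a' b' c' d' (by subst ha hb hc hd; exact h) := by
  subst ha hb hc hd; rfl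

lemma closure_sl₂_eq_top [Fact p.Prime] : Submonoid.closure
    {sl₂ (1 : ZMod p) 1 0 1 (by ring), sl₂ (0 : ZMod p) (-1) 1 0 (by ring)} = ⊤ := by
  set M := Submonoid.closure
    {sl₂ (1 : ZMod p) 1 0 1 (by ring), sl₂ (0 : ZMod p) (-1) 1 0 (by ring)}
  have hT : sl₂ (1 : ZMod p) 1 0 1 (by ring) ∈ M := Submonoid.subset_closure (by simp)
  have hS : sl₂ (0 : ZMod p) (-1) 1 0 (by ring) ∈ M := Submonoid.subset_closure (by simp)
  have hS' : sl₂ (0 : ZMod p) 1 (-1) 0 (by ring) ∈ M := by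
    convert mul_mem hS (mul_mem hS hS) using 1
    simp only [sl₂_mul_sl₂]
    exact sl₂_congr (by ring) (by ring) (by ring) (by ring)
  have hU (x : ZMod p) : sl₂ 1 x 0 1 (by ring) ∈ M := by
    obtain ⟨n, rfl⟩ := ZMod.natCast_zmod_surjective x
    induction n with
    | zero =>
      convert one_mem M
      exact Subtype.ext (by simp [sl₂, Matrix.one_fin_two])
    | succ n ih =>
      convert mul_mem hT ih using 1
      rw [sl₂_mul_sl₂]
      exact sl₂_congr (by ring) (by push_cast; ring) (by ring) (by ring)
  have hL (x : ZMod p) : sl₂ 1 0 x 1 (by ring) ∈ M := by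
    convert mul_mem hS (mul_mem (hU (-x)) hS') using 1
    simp only [sl₂_mul_sl₂]
    exact sl₂_congr (by ring) (by ring) (by ring) (by ring)
  have main {a b c d : ZMod p} (h : a * d - b * c = 1) (hc : c ≠ 0) : sl₂ a b c d h ∈ M := by
    convert mul_mem (hU ((a - 1) / c)) (mul_mem (hL c) (hU ((d - 1) / c))) using 1
    simp only [sl₂_mul_sl₂]
    refine sl₂_congr ?_ ?_ ?_ ?_
    · field_simp; ring
    · field_simp; linear_combination -h
    · ring
    · field_simp; ring
  refine (Submonoid.eq_top_iff' _).2 fun g => ?_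
  obtain ⟨a, b, c, d, h, rfl⟩ := eq_sl₂ g
  by_cases hc : c = 0
  · have ha : a ≠ 0 := by
      rintro rfl
      simp [hc] at h
    convert mul_mem hS' (main (a := -c) (b := -d) (c := a) (d := b) (by linear_combination h) ha)
      using 1
    rw [sl₂_mul_sl₂]
    exact sl₂_congr (by ring) (by ring) (by ring) (by ring)
  · exact main h hc

variable {P H : ZMod p → Matrix (Fin 2) (Fin 2) (ZMod q)} {s : Matrix (Fin 2) (Fin 2) (ZMod q)}

lemma IsBruhatDatum.exists_hom [Fact p.Prime] (h : IsBruhatDatum P H s) :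
    ∃ f : SL₂ (ZMod p) →* SL₂ (ZMod q), Function.Injective f ∧ ∀ a b c d h,
      (f (sl₂ a b c d h) : Matrix (Fin 2) (Fin 2) (ZMod q)) = bruhatMap P H s a b c d := by
  let f (g : SL₂ (ZMod p)) : SL₂ (ZMod q) := ⟨bruhatMap P H s (g 0 0) (g 0 1) (g 1 0) (g 1 1),
    (h.2 _ _ _ _ (by rw [← Matrix.det_fin_two, g.det_coe])).2.2.1⟩
  have hf {a b c d : ZMod p} (h) : (f (sl₂ a b c d h)).1 = bruhatMap P H s a b c d := rfl
  have h₁ : f 1 = 1 := Subtype.ext (by simpa [f] using h.1)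
  have hT : (f (sl₂ 1 1 0 1 (by ring))).1 = P 1 := by
    have := (h.2 1 0 0 1 (by ring)).1
    rw [hf]
    simpa [h.1] using this
  have hS : (f (sl₂ 0 (-1) 1 0 (by ring))).1 = s := by
    have := (h.2 1 0 0 1 (by ring)).2.1
    rw [hf]
    simpa [h.1] using this
  refine ⟨MonoidHom.ofClosureMEqTopLeft f closure_sl₂_eq_top h₁ ?_, ?_, fun a b c d h => rfl⟩
  · rintro x hx y
    obtain ⟨a, b, c, d, hy, rfl⟩ := eq_sl₂ y
    obtain rfl | rfl := hx
    · refine Subtype.ext ?_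
      rw [sl₂_mul_sl₂, hf, Matrix.SpecialLinearGroup.coe_mul, hT, hf, ← (h.2 a b c d hy).1]
      simp
    · refine Subtype.ext ?_
      rw [sl₂_mul_sl₂, hf, Matrix.SpecialLinearGroup.coe_mul, hS, hf, ← (h.2 a b c d hy).2.1]
      simp
  · refine (injective_iff_map_eq_one _).2 fun g hg => ?_
    obtain ⟨a, b, c, d, hy, rfl⟩ := eq_sl₂ g
    obtain ⟨rfl, rfl, rfl, rfl⟩ := (h.2 a b c d hy).2.2.2 (congrArg Subtype.val hg)
    exact Subtype.ext (by simp [sl₂, Matrix.one_fin_two])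

/-- An embedding of `SL₂(𝔽_p)` in `SL₂(𝔽_q)` with image of order `(q + 1) * m` containing a diagonal
element of order `m` gives a cocompact lattice. -/
theorem IsBruhatDatum.exists_generatesCocompactLattice [Fact p.Prime] [Fact q.Prime]
    (h : IsBruhatDatum P H s) {a b c d : ZMod p} {hg : a * d - b * c = 1}
    (h01 : bruhatMap P H s a b c d 0 1 = 0) (h10 : bruhatMap P H s a b c d 1 0 = 0) {m : ℕ}
    (hord : orderOf (sl₂ a b c d hg) = m) (hcard : Nat.card (SL₂ (ZMod p)) = (q + 1) * m)
    (hgcd : ((q + 1) * m).gcd (q - 1) = m) (hq : ((q + 1) * m).Coprime q) :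
    ∃ A₁ A₂ : Subgroup (SL₂ (ZMod q)⸨X⸩), Nonempty (A₁ ≃* SL₂ (ZMod p)) ∧
      Nonempty (A₂ ≃* SL₂ (ZMod p)) ∧ IsCyclic ↥(A₁ ⊓ A₂) ∧ Nat.card ↥(A₁ ⊓ A₂) = m ∧
      GeneratesCocompactLattice q A₁ A₂ := by
  obtain ⟨f, hf, hf'⟩ := h.exists_hom
  let e := MonoidHom.ofInjective hf
  obtain ⟨A₁, A₂, ⟨e₁⟩, ⟨e₂⟩, hA⟩ := _root_.exists_generatesCocompactLattice f.range
    (d := f (sl₂ a b c d hg)) ⟨_, rfl⟩ (by rw [hf', h01]) (by rw [hf', h10])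
    ((orderOf_injective f hf _).trans hord) ((Nat.card_congr e.toEquiv.symm).trans hcard) hgcd hq
  exact ⟨A₁, A₂, ⟨(e.trans e₁).symm⟩, ⟨(e.trans e₂).symm⟩, hA⟩

end Bruhat

section SpecialLinearEmbeddings

instance : Fact (Nat.Prime 5) := ⟨by norm_num⟩

lemma natCard_SL₂_three : Nat.card (SL₂ (ZMod 3)) = 24 := by
  rw [Nat.card_eq_fintype_card]
  decide +kernel

lemma natCard_SL₂_five : Nat.card (SL₂ (ZMod 5)) = 120 := by
  rw [Nat.card_eq_fintype_card]
  decide +kernel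

lemma orderOf_neg_one_SL₂ {F : Type*} [Field F] (h : (2 : F) ≠ 0) :
    orderOf (-1 : SL₂ F) = 2 := by
  refine orderOf_eq_prime (by simp) fun h' => h ?_
  have := congrArg (fun g : SL₂ F => g 0 0) h'
  simp only [Matrix.SpecialLinearGroup.coe_neg, Matrix.SpecialLinearGroup.coe_one,
    Matrix.neg_apply, Matrix.one_apply_eq] at this
  linear_combination -this

lemma sl₂_neg_one {R : Type*} [CommRing R] : sl₂ (-1 : R) 0 0 (-1) (by ring) = -1 :=
  Subtype.ext (by simp [sl₂, Matrix.one_fin_two])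

/-- The images in `SL₂(𝔽_11)` of the upper unipotent elements of `SL₂(𝔽_3)`. -/
def threeElevenUnipotent : ZMod 3 → Matrix (Fin 2) (Fin 2) (ZMod 11) :=
  ![1, !![1, 6; 5, 9], !![9, 5; 6, 1]]

/-- The images in `SL₂(𝔽_11)` of the diagonal elements of `SL₂(𝔽_3)`. -/
def threeElevenDiagonal : ZMod 3 → Matrix (Fin 2) (Fin 2) (ZMod 11) :=
  ![0, 1, -1]

lemma isBruhatDatum_three_eleven :
    IsBruhatDatum threeElevenUnipotent threeElevenDiagonal !![0, -1; 1, 0] := by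
  decide +kernel

/-- The images in `SL₂(𝔽_11)` of the upper unipotent elements of `SL₂(𝔽_5)`. -/
def fiveElevenUnipotent : ZMod 5 → Matrix (Fin 2) (Fin 2) (ZMod 11) :=
  ![1, !![3, 0; 0, 4], !![9, 0; 0, 5], !![5, 0; 0, 9], !![4, 0; 0, 3]]

/-- The images in `SL₂(𝔽_11)` of the diagonal elements of `SL₂(𝔽_5)`. -/
def fiveElevenDiagonal : ZMod 5 → Matrix (Fin 2) (Fin 2) (ZMod 11) :=
  ![0, 1, !![0, 4; 8, 0], !![0, 7; 3, 0], -1]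

lemma isBruhatDatum_five_eleven :
    IsBruhatDatum fiveElevenUnipotent fiveElevenDiagonal !![10, 1; 9, 1] := by
  decide +kernel

/-- The images in `SL₂(𝔽_19)` of the upper unipotent elements of `SL₂(𝔽_5)`. -/
def fiveNineteenUnipotent : ZMod 5 → Matrix (Fin 2) (Fin 2) (ZMod 19) :=
  ![1, !![11, 7; 16, 12], !![5, 9; 7, 9], !![9, 10; 12, 5], !![12, 12; 3, 11]]

/-- The images in `SL₂(𝔽_19)` of the diagonal elements of `SL₂(𝔽_5)`. -/
def fiveNineteenDiagonal : ZMod 5 → Matrix (Fin 2) (Fin 2) (ZMod 19) :=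
  ![0, 1, !![13, 16; 6, 6], !![6, 3; 13, 13], -1]

lemma isBruhatDatum_five_nineteen :
    IsBruhatDatum fiveNineteenUnipotent fiveNineteenDiagonal !![1, 1; 17, 18] := by
  decide +kernel

/-- The images in `SL₂(𝔽_59)` of the upper unipotent elements of `SL₂(𝔽_5)`. -/
def fiveFiftyNineUnipotent : ZMod 5 → Matrix (Fin 2) (Fin 2) (ZMod 59) :=
  ![1, !![1, 10; 9, 32], !![32, 35; 2, 52], !![52, 24; 57, 32], !![32, 49; 50, 1]]

/-- The images in `SL₂(𝔽_59)` of the diagonal elements of `SL₂(𝔽_5)`. -/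
def fiveFiftyNineDiagonal : ZMod 5 → Matrix (Fin 2) (Fin 2) (ZMod 59) :=
  ![0, 1, !![37, 20; 20, 22], !![22, 39; 39, 37], -1]

lemma isBruhatDatum_five_fiftyNine :
    IsBruhatDatum fiveFiftyNineUnipotent fiveFiftyNineDiagonal !![0, -1; 1, 0] := by
  decide +kernel

lemma orderOf_sl₂_five_ten : orderOf (sl₂ (-1 : ZMod 5) 1 0 (-1) (by ring)) = 10 :=
  (orderOf_eq_iff (by norm_num)).2 (by decide +kernel)

lemma orderOf_sl₂_five_six : orderOf (sl₂ (0 : ZMod 5) (-1) 1 1 (by ring)) = 6 :=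
  (orderOf_eq_iff (by norm_num)).2 (by decide +kernel)

theorem exists_lattice_eleven_SL₂_three :
    ∃ A₁ A₂ : Subgroup (SL₂ (ZMod 11)⸨X⸩), Nonempty (A₁ ≃* SL₂ (ZMod 3)) ∧
      Nonempty (A₂ ≃* SL₂ (ZMod 3)) ∧ IsCyclic ↥(A₁ ⊓ A₂) ∧ Nat.card ↥(A₁ ⊓ A₂) = 2 ∧
      GeneratesCocompactLattice 11 A₁ A₂ :=
  isBruhatDatum_three_eleven.exists_generatesCocompactLattice (a := -1) (b := 0) (c := 0) (d := -1)
    (hg := by ring) (by decide +kernel) (by decide +kernel)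
    (by rw [sl₂_neg_one, orderOf_neg_one_SL₂ (by decide)]) natCard_SL₂_three (by norm_num)
    (by norm_num)

theorem exists_lattice_eleven_SL₂_five :
    ∃ A₁ A₂ : Subgroup (SL₂ (ZMod 11)⸨X⸩), Nonempty (A₁ ≃* SL₂ (ZMod 5)) ∧
      Nonempty (A₂ ≃* SL₂ (ZMod 5)) ∧ IsCyclic ↥(A₁ ⊓ A₂) ∧ Nat.card ↥(A₁ ⊓ A₂) = 10 ∧
      GeneratesCocompactLattice 11 A₁ A₂ :=
  isBruhatDatum_five_eleven.exists_generatesCocompactLattice (a := -1) (b := 1) (c := 0) (d := -1)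
    (hg := by ring) (by decide +kernel) (by decide +kernel)
    orderOf_sl₂_five_ten natCard_SL₂_five (by norm_num) (by norm_num)

theorem exists_lattice_nineteen_SL₂_five :
    ∃ A₁ A₂ : Subgroup (SL₂ (ZMod 19)⸨X⸩), Nonempty (A₁ ≃* SL₂ (ZMod 5)) ∧
      Nonempty (A₂ ≃* SL₂ (ZMod 5)) ∧ IsCyclic ↥(A₁ ⊓ A₂) ∧ Nat.card ↥(A₁ ⊓ A₂) = 6 ∧
      GeneratesCocompactLattice 19 A₁ A₂ :=
  isBruhatDatum_five_nineteen.exists_generatesCocompactLattice (a := 0) (b := -1) (c := 1) (d := 1)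
    (hg := by ring) (by decide +kernel) (by decide +kernel)
    orderOf_sl₂_five_six natCard_SL₂_five (by norm_num) (by norm_num)

theorem exists_lattice_fiftyNine_SL₂_five :
    ∃ A₁ A₂ : Subgroup (SL₂ (ZMod 59)⸨X⸩), Nonempty (A₁ ≃* SL₂ (ZMod 5)) ∧
      Nonempty (A₂ ≃* SL₂ (ZMod 5)) ∧ IsCyclic ↥(A₁ ⊓ A₂) ∧ Nat.card ↥(A₁ ⊓ A₂) = 2 ∧
      GeneratesCocompactLattice 59 A₁ A₂ :=
  isBruhatDatum_five_fiftyNine.exists_generatesCocompactLattice (a := -1) (b := 0) (c := 0)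
    (d := -1) (hg := by ring) (by decide +kernel) (by decide +kernel)
    (by rw [sl₂_neg_one, orderOf_neg_one_SL₂ (by decide)]) natCard_SL₂_five (by norm_num)
    (by norm_num)

end SpecialLinearEmbeddings

section BinaryOctahedral

lemma IsBinaryOctahedral.of_mulEquiv {G G' : Type*} [Group G] [Group G'] {A : Subgroup G}
    {B : Subgroup G'} (h : IsBinaryOctahedral A) (e : A ≃* B) : IsBinaryOctahedral B := by
  obtain ⟨hcard, ⟨x, hx, hx'⟩, ⟨f⟩⟩ := h
  refine ⟨(Nat.card_congr e.symm.toEquiv).trans hcard,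
    ⟨e x, (e.orderOf_eq x).trans hx, fun y hy => ?_⟩,
    ⟨.trans (QuotientGroup.congr _ _ e.symm ?_) f⟩⟩
  · rw [← hx' (e.symm y) ((e.symm.orderOf_eq y).trans hy), e.apply_symm_apply]
  · ext y
    simp only [Subgroup.mem_map, Subgroup.mem_center_iff]
    constructor
    · rintro ⟨z, hz, rfl⟩ g
      simpa using congrArg e.symm (hz (e g))
    · exact fun hy => ⟨e y, fun g => by simpa using congrArg e (hy (e.symm g)), by simp⟩

lemma center_perm_fin_four {σ : Equiv.Perm (Fin 4)} (h : ∀ τ, τ * σ = σ * τ) : σ = 1 := by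
  revert σ
  decide +kernel

variable {F : Type*} [Field F]

lemma eq_one_or_eq_neg_one_of_sq_eq_one (h2 : (2 : F) ≠ 0) {g : SL₂ F} (hg : g ^ 2 = 1) :
    g = 1 ∨ g = -1 := by
  obtain ⟨a, b, c, d, h, rfl⟩ := eq_sl₂ g
  rw [pow_two, sl₂_mul_sl₂] at hg
  have h00 : a * a + b * c = 1 := congrArg (fun g : SL₂ F => g 0 0) hg
  have h01 : a * b + b * d = 0 := congrArg (fun g : SL₂ F => g 0 1) hg
  have h10 : c * a + d * c = 0 := congrArg (fun g : SL₂ F => g 1 0) hg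
  have h11 : c * b + d * d = 1 := congrArg (fun g : SL₂ F => g 1 1) hg
  have hb : b = 0 := by
    refine (mul_eq_zero.1 ?_).resolve_left h2
    linear_combination d * h01 - b * h - b * h11
  have hc : c = 0 := by
    refine (mul_eq_zero.1 ?_).resolve_left h2
    linear_combination d * h10 - c * h - c * h11
  subst hb hc
  obtain rfl : a = d := by linear_combination d * h00 - a * h
  have ha : (a - 1) * (a + 1) = 0 := by linear_combination h
  obtain ha | ha := mul_eq_zero.1 ha
  · obtain rfl := sub_eq_zero.1 ha
    exact .inl (Subtype.ext (by simp [sl₂, Matrix.one_fin_two]))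
  · obtain rfl := eq_neg_of_add_eq_zero_left ha
    exact .inr sl₂_neg_one

lemma isBinaryOctahedral_of_hom (h2 : (2 : F) ≠ 0) {A : Subgroup (SL₂ F)} (hA : -1 ∈ A)
    (π : A →* Equiv.Perm (Fin 4)) (hπ : Function.Surjective π)
    (hker : ∀ g, π g = 1 → g.1 = 1 ∨ g.1 = -1) : IsBinaryOctahedral A := by
  have hcomm (g : A) : g * ⟨-1, hA⟩ = ⟨-1, hA⟩ * g := Subtype.ext (by simp)
  have hneg : π ⟨-1, hA⟩ = 1 := by
    refine center_perm_fin_four fun τ => ?_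
    obtain ⟨g, rfl⟩ := hπ τ
    rw [← map_mul, hcomm, map_mul]
  have hord : orderOf (⟨-1, hA⟩ : A) = 2 := by
    rw [← Subgroup.orderOf_coe]
    exact orderOf_neg_one_SL₂ h2
  have hcenter : Subgroup.center A = π.ker := by
    ext g
    rw [Subgroup.mem_center_iff, MonoidHom.mem_ker]
    refine ⟨fun h => center_perm_fin_four fun τ => ?_, fun h x => ?_⟩
    · obtain ⟨x, rfl⟩ := hπ τ
      rw [← map_mul, h, map_mul]
    · obtain h | h := hker g h
      · obtain rfl : g = 1 := Subtype.ext h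
        simp
      · obtain rfl : g = ⟨-1, hA⟩ := Subtype.ext h
        exact hcomm x
  have hkercard : Nat.card π.ker = 2 := by
    have hker' : π.ker = Subgroup.zpowers ⟨-1, hA⟩ := by
      refine le_antisymm (fun g hg => ?_) (by rwa [Subgroup.zpowers_le])
      obtain h | h := hker g hg
      · obtain rfl : g = 1 := Subtype.ext h
        exact one_mem _
      · obtain rfl : g = ⟨-1, hA⟩ := Subtype.ext h
        exact Subgroup.mem_zpowers _
    rw [hker', Nat.card_zpowers, hord]
  refine ⟨?_, ⟨⟨-1, hA⟩, hord, fun y hy => ?_⟩,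
    ⟨(QuotientGroup.quotientMulEquivOfEq hcenter).trans
      (QuotientGroup.quotientKerEquivOfSurjective π hπ)⟩⟩
  · rw [← π.ker.card_mul_index, Subgroup.index_ker, MonoidHom.range_eq_top.2 hπ, hkercard,
      Subgroup.card_top, Nat.card_perm, Nat.card_eq_fintype_card]
    rfl
  · have hsq : y ^ 2 = 1 := orderOf_dvd_iff_pow_eq_one.1 hy.dvd
    refine Subtype.ext ((eq_one_or_eq_neg_one_of_sq_eq_one h2
      (by simpa using congrArg Subtype.val hsq)).resolve_left fun h => ?_)
    obtain rfl : y = 1 := Subtype.ext h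
    simp at hy

/-- The subgroup of `SL₂` whose conjugation action permutes the matrices `v i` up to sign. -/
def signedStabilizer (v : Fin 4 → Matrix (Fin 2) (Fin 2) F) : Subgroup (SL₂ F) where
  carrier := {g | ∃ σ : Equiv.Perm (Fin 4), ∀ i, ∃ ε : ℤˣ, g.1 * v i = ε • (v (σ i) * g.1)}
  one_mem' := ⟨1, fun i => ⟨1, by simp⟩⟩
  mul_mem' := by
    rintro g h ⟨σ, hσ⟩ ⟨τ, hτ⟩
    refine ⟨σ * τ, fun i => ?_⟩
    obtain ⟨ε, hε⟩ := hτ i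
    obtain ⟨δ, hδ⟩ := hσ (τ i)
    refine ⟨ε * δ, ?_⟩
    rw [Matrix.SpecialLinearGroup.coe_mul, mul_assoc, hε, mul_smul_comm, ← mul_assoc, hδ,
      smul_mul_assoc, mul_smul, mul_assoc, Equiv.Perm.mul_apply]
  inv_mem' := by
    rintro g ⟨σ, hσ⟩
    refine ⟨σ⁻¹, fun i => ?_⟩
    obtain ⟨ε, hε⟩ := hσ (σ⁻¹ i)
    rw [← Equiv.Perm.mul_apply, mul_inv_cancel, Equiv.Perm.one_apply] at hε
    have h₁ : g⁻¹.1 * g.1 = 1 := congrArg Subtype.val (inv_mul_cancel g)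
    have h₂ : g.1 * g⁻¹.1 = 1 := congrArg Subtype.val (mul_inv_cancel g)
    have := congrArg (fun x => ε⁻¹ • (g⁻¹.1 * x * g⁻¹.1)) hε
    refine ⟨ε⁻¹, ?_⟩
    simp only [mul_smul_comm, smul_mul_assoc, inv_smul_smul, mul_assoc, h₂, mul_one] at this
    rw [← this, ← mul_assoc g⁻¹.1, h₁, one_mul]

/-- Four lines in the trace zero matrices, spanned by `v i`, that are permuted by a group of type
`2S₄` like the diagonals of a cube. -/
structure IsCubeDiagonals (v : Fin 4 → Matrix (Fin 2) (Fin 2) F) (r : F) : Prop where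
  injective : ∀ i j, ∀ ε : ℤˣ, v i = ε • v j → i = j
  sum_eq_zero : ∑ i, v i = 0
  eq_of_sum_eq_zero : ∀ ε : Fin 4 → ℤˣ, ∑ i, ε i • v i = 0 → ∀ i, ε i = ε 0
  det_sub : ∀ i j, i ≠ j → (r • (v i - v j)).det = 1
  sub_mul : ∀ i j k, i ≠ j → (v i - v j) * v k = -(v (Equiv.swap i j k) * (v i - v j))
  ne : (v 0 * v 1) 1 0 * (v 0 * v 2) 0 1 ≠ (v 0 * v 1) 0 1 * (v 0 * v 2) 1 0

lemma eq_one_or_eq_neg_one_of_commute {y z : Matrix (Fin 2) (Fin 2) F}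
    (h : y 1 0 * z 0 1 ≠ y 0 1 * z 1 0) {g : SL₂ F} (hy : Commute g.1 y) (hz : Commute g.1 z) :
    g = 1 ∨ g = -1 := by
  obtain ⟨a, b, c, d, hg, rfl⟩ := eq_sl₂ g
  have key {w : Matrix (Fin 2) (Fin 2) F} (hw : Commute (sl₂ a b c d hg).1 w) :
      b * w 1 0 = c * w 0 1 ∧ (a - d) * w 0 1 = b * (w 0 0 - w 1 1) ∧
        (a - d) * w 1 0 = c * (w 0 0 - w 1 1) := by
    have h00 := congrFun₂ hw.eq 0 0
    have h01 := congrFun₂ hw.eq 0 1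
    have h10 := congrFun₂ hw.eq 1 0
    simp only [sl₂, Matrix.mul_apply, Fin.sum_univ_two, Matrix.of_apply, Matrix.cons_val_zero,
      Matrix.cons_val_one, Matrix.cons_val', Matrix.cons_val_fin_one] at h00 h01 h10
    exact ⟨by linear_combination h00, by linear_combination h01, by linear_combination -h10⟩
  obtain ⟨hy₁, hy₂, hy₃⟩ := key hy
  obtain ⟨hz₁, -, -⟩ := key hz
  have hb : b = 0 := by
    refine (mul_eq_zero.1 ?_).resolve_right (sub_ne_zero.2 h)
    linear_combination z 0 1 * hy₁ - y 0 1 * hz₁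
  have hc : c = 0 := by
    refine (mul_eq_zero.1 ?_).resolve_right (sub_ne_zero.2 h)
    linear_combination z 1 0 * hy₁ - y 1 0 * hz₁
  subst hb hc
  have had : a = d := by
    by_contra had
    rw [zero_mul, mul_eq_zero, or_iff_right (sub_ne_zero.2 had)] at hy₂ hy₃
    simp [hy₂, hy₃] at h
  subst had
  obtain ha | ha := mul_eq_zero.1 (show (a - 1) * (a + 1) = 0 by linear_combination hg)
  · obtain rfl := sub_eq_zero.1 ha
    exact .inl (Subtype.ext (by simp [sl₂, Matrix.one_fin_two]))
  · obtain rfl := eq_neg_of_add_eq_zero_left ha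
    exact .inr sl₂_neg_one

variable {v : Fin 4 → Matrix (Fin 2) (Fin 2) F} {r : F}

lemma neg_one_mem_signedStabilizer : -1 ∈ signedStabilizer v :=
  ⟨1, fun i => ⟨1, by simp⟩⟩

theorem IsCubeDiagonals.isBinaryOctahedral (hv : IsCubeDiagonals v r) (h2 : (2 : F) ≠ 0) :
    IsBinaryOctahedral (signedStabilizer v) := by
  have cancel (g : SL₂ F) {x y : Matrix (Fin 2) (Fin 2) F} (h : x * g.1 = y * g.1) : x = y := by
    have h₂ : g.1 * g⁻¹.1 = 1 := congrArg Subtype.val (mul_inv_cancel g)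
    simpa only [mul_assoc, h₂, mul_one] using congrArg (· * g⁻¹.1) h
  have uniq {g : SL₂ F} {σ τ : Equiv.Perm (Fin 4)}
      (hσ : ∀ i, ∃ ε : ℤˣ, g.1 * v i = ε • (v (σ i) * g.1))
      (hτ : ∀ i, ∃ ε : ℤˣ, g.1 * v i = ε • (v (τ i) * g.1)) : σ = τ := by
    ext1 i
    obtain ⟨ε, hε⟩ := hσ i
    obtain ⟨δ, hδ⟩ := hτ i
    refine hv.injective _ _ (ε⁻¹ * δ) (cancel g ?_)
    rw [smul_mul_assoc, mul_smul, ← hδ, hε, inv_smul_smul]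
  choose π hπ using fun g : signedStabilizer v => g.2
  have hmul (g h) : π (g * h) = π g * π h := by
    refine uniq (hπ (g * h)) fun i => ?_
    obtain ⟨ε, hε⟩ := hπ h i
    obtain ⟨δ, hδ⟩ := hπ g (π h i)
    refine ⟨ε * δ, ?_⟩
    rw [Subgroup.coe_mul, Matrix.SpecialLinearGroup.coe_mul, mul_assoc, hε, mul_smul_comm,
      ← mul_assoc, hδ, smul_mul_assoc, mul_smul, mul_assoc, Equiv.Perm.mul_apply]
  refine isBinaryOctahedral_of_hom h2 neg_one_mem_signedStabilizer (MonoidHom.mk' π hmul) ?_ ?_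
  · rw [← MonoidHom.range_eq_top, eq_top_iff, ← Equiv.Perm.closure_isSwap, Subgroup.closure_le]
    rintro _ ⟨i, j, hij, rfl⟩
    have hw (k) : (r • (v i - v j)) * v k =
        (-1 : ℤˣ) • (v (Equiv.swap i j k) * r • (v i - v j)) := by
      rw [smul_mul_assoc, hv.sub_mul i j k hij, mul_smul_comm, Units.neg_smul, one_smul, smul_neg]
    exact ⟨⟨⟨_, hv.det_sub i j hij⟩, _, fun k => ⟨_, hw k⟩⟩, uniq (hπ _) fun k => ⟨_, hw k⟩⟩
  · intro g hg
    choose ε hε using hπ g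
    replace hε (i) : g.1.1 * v i = ε i • (v i * g.1.1) := by
      rw [hε, show π g = 1 from hg, Equiv.Perm.one_apply]
    have hε' := hv.eq_of_sum_eq_zero ε <| cancel g.1 <| by
      simp only [zero_mul, Finset.sum_mul, smul_mul_assoc, ← hε, ← Finset.mul_sum, hv.sum_eq_zero,
        mul_zero]
    have hcomm (i) : Commute g.1.1 (v 0 * v i) := by
      rw [Commute, SemiconjBy, ← mul_assoc, hε, smul_mul_assoc, mul_assoc, hε, hε' i,
        mul_smul_comm, smul_smul, Int.units_mul_self, one_smul, mul_assoc]
    exact eq_one_or_eq_neg_one_of_commute hv.ne (hcomm 1) (hcomm 2)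

theorem exists_lattice_isBinaryOctahedral {q : ℕ} [Fact q.Prime]
    {v : Fin 4 → Matrix (Fin 2) (Fin 2) (ZMod q)} {r : ZMod q} (hv : IsCubeDiagonals v r)
    (h2 : (2 : ZMod q) ≠ 0) {d : SL₂ (ZMod q)} (hd : d ∈ signedStabilizer v) (h01 : d 0 1 = 0)
    (h10 : d 1 0 = 0) {m : ℕ} (hord : orderOf d = m) (hcard : 48 = (q + 1) * m)
    (hgcd : ((q + 1) * m).gcd (q - 1) = m) (hq : ((q + 1) * m).Coprime q) :
    ∃ A₁ A₂ : Subgroup (SL₂ (ZMod q)⸨X⸩), IsBinaryOctahedral A₁ ∧ IsBinaryOctahedral A₂ ∧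
      IsCyclic ↥(A₁ ⊓ A₂) ∧ Nat.card ↥(A₁ ⊓ A₂) = m ∧ GeneratesCocompactLattice q A₁ A₂ := by
  have h := hv.isBinaryOctahedral h2
  obtain ⟨A₁, A₂, ⟨e₁⟩, ⟨e₂⟩, hA⟩ :=
    exists_generatesCocompactLattice _ hd h01 h10 hord (h.1.trans hcard) hgcd hq
  exact ⟨A₁, A₂, h.of_mulEquiv e₁, h.of_mulEquiv e₂, hA⟩

/-- The diagonals `I + J + K`, `I - J - K`, `-I + J - K`, `-I - J + K` for the quaternion units
`I = (4, 1; 4, 3)`, `J = (4, 2; 2, 3)`, `K = I J` over `𝔽₇`. -/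
def cubeDiagonalsSeven : Fin 4 → Matrix (Fin 2) (Fin 2) (ZMod 7) :=
  let I := !![4, 1; 4, 3]
  let J := !![4, 2; 2, 3]
  ![I + J + I * J, I - J - I * J, -I + J - I * J, -I - J + I * J]

/-- The diagonals `I + J + K`, `I - J - K`, `-I + J - K`, `-I - J + K` for the quaternion units
`I = (0, -1; 1, 0)`, `J = (2, 8; 8, -2)`, `K = I J` over `𝔽₂₃`. -/
def cubeDiagonalsTwentyThree : Fin 4 → Matrix (Fin 2) (Fin 2) (ZMod 23) :=
  let I := !![0, -1; 1, 0]
  let J := !![2, 8; 8, -2]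
  ![I + J + I * J, I - J - I * J, -I + J - I * J, -I - J + I * J]

lemma isCubeDiagonals_seven : IsCubeDiagonals cubeDiagonalsSeven 1 where
  injective := by decide +kernel
  sum_eq_zero := by decide +kernel
  eq_of_sum_eq_zero := by decide +kernel
  det_sub := by decide +kernel
  sub_mul := by decide +kernel
  ne := by decide +kernel

lemma isCubeDiagonals_twentyThree : IsCubeDiagonals cubeDiagonalsTwentyThree 7 where
  injective := by decide +kernel
  sum_eq_zero := by decide +kernel
  eq_of_sum_eq_zero := by decide +kernel
  det_sub := by decide +kernel
  sub_mul := by decide +kernel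
  ne := by decide +kernel

lemma orderOf_sl₂_seven : orderOf (sl₂ (3 : ZMod 7) 0 0 5 (by decide)) = 6 :=
  (orderOf_eq_iff (by norm_num)).2 (by decide +kernel)

lemma sl₂_seven_mem_signedStabilizer :
    sl₂ (3 : ZMod 7) 0 0 5 (by decide) ∈ signedStabilizer cubeDiagonalsSeven := by
  change ∃ σ : Equiv.Perm (Fin 4), _
  decide +kernel

theorem exists_lattice_seven_isBinaryOctahedral :
    ∃ A₁ A₂ : Subgroup (SL₂ (ZMod 7)⸨X⸩), IsBinaryOctahedral A₁ ∧ IsBinaryOctahedral A₂ ∧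
      IsCyclic ↥(A₁ ⊓ A₂) ∧ Nat.card ↥(A₁ ⊓ A₂) = 6 ∧ GeneratesCocompactLattice 7 A₁ A₂ :=
  exists_lattice_isBinaryOctahedral isCubeDiagonals_seven (by decide)
    sl₂_seven_mem_signedStabilizer rfl rfl orderOf_sl₂_seven (by norm_num) (by norm_num)
    (by norm_num)

theorem exists_lattice_twentyThree_isBinaryOctahedral :
    ∃ A₁ A₂ : Subgroup (SL₂ (ZMod 23)⸨X⸩), IsBinaryOctahedral A₁ ∧ IsBinaryOctahedral A₂ ∧
      IsCyclic ↥(A₁ ⊓ A₂) ∧ Nat.card ↥(A₁ ⊓ A₂) = 2 ∧ GeneratesCocompactLattice 23 A₁ A₂ :=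
  exists_lattice_isBinaryOctahedral isCubeDiagonals_twentyThree (by decide)
    neg_one_mem_signedStabilizer (by simp) (by simp) (orderOf_neg_one_SL₂ (by decide))
    (by norm_num) (by norm_num) (by norm_num)

end BinaryOctahedral

/-- The exceptional edge-transitive cocompact lattices in `SL₂(𝔽_q((u)))`
for `q ∈ {7, 11, 19, 23, 59}`. -/
theorem exceptional_lattices_q_three_mod_four :
    (∃ A₁ A₂ : Subgroup (Matrix.SpecialLinearGroup (Fin 2) (LaurentSeries (ZMod 7))),
      IsBinaryOctahedral A₁ ∧ IsBinaryOctahedral A₂ ∧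
      IsCyclic ↥(A₁ ⊓ A₂) ∧ Nat.card ↥(A₁ ⊓ A₂) = 6 ∧
      GeneratesCocompactLattice 7 A₁ A₂) ∧
    (∃ A₁ A₂ : Subgroup (Matrix.SpecialLinearGroup (Fin 2) (LaurentSeries (ZMod 11))),
      Nonempty (A₁ ≃* Matrix.SpecialLinearGroup (Fin 2) (ZMod 3)) ∧
      Nonempty (A₂ ≃* Matrix.SpecialLinearGroup (Fin 2) (ZMod 3)) ∧
      Nat.card ↥(A₁ ⊓ A₂) = 2 ∧
      GeneratesCocompactLattice 11 A₁ A₂) ∧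
    (∃ A₁ A₂ : Subgroup (Matrix.SpecialLinearGroup (Fin 2) (LaurentSeries (ZMod 11))),
      Nonempty (A₁ ≃* Matrix.SpecialLinearGroup (Fin 2) (ZMod 5)) ∧
      Nonempty (A₂ ≃* Matrix.SpecialLinearGroup (Fin 2) (ZMod 5)) ∧
      IsCyclic ↥(A₁ ⊓ A₂) ∧ Nat.card ↥(A₁ ⊓ A₂) = 10 ∧
      GeneratesCocompactLattice 11 A₁ A₂) ∧
    (∃ A₁ A₂ : Subgroup (Matrix.SpecialLinearGroup (Fin 2) (LaurentSeries (ZMod 19))),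
      Nonempty (A₁ ≃* Matrix.SpecialLinearGroup (Fin 2) (ZMod 5)) ∧
      Nonempty (A₂ ≃* Matrix.SpecialLinearGroup (Fin 2) (ZMod 5)) ∧
      IsCyclic ↥(A₁ ⊓ A₂) ∧ Nat.card ↥(A₁ ⊓ A₂) = 6 ∧
      GeneratesCocompactLattice 19 A₁ A₂) ∧
    (∃ A₁ A₂ : Subgroup (Matrix.SpecialLinearGroup (Fin 2) (LaurentSeries (ZMod 23))),
      IsBinaryOctahedral A₁ ∧ IsBinaryOctahedral A₂ ∧
      Nat.card ↥(A₁ ⊓ A₂) = 2 ∧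
      GeneratesCocompactLattice 23 A₁ A₂) ∧
    (∃ A₁ A₂ : Subgroup (Matrix.SpecialLinearGroup (Fin 2) (LaurentSeries (ZMod 59))),
      Nonempty (A₁ ≃* Matrix.SpecialLinearGroup (Fin 2) (ZMod 5)) ∧
      Nonempty (A₂ ≃* Matrix.SpecialLinearGroup (Fin 2) (ZMod 5)) ∧
      Nat.card ↥(A₁ ⊓ A₂) = 2 ∧
      GeneratesCocompactLattice 59 A₁ A₂) := by
  obtain ⟨B₁, B₂, hB₁, hB₂, -, hB⟩ := exists_lattice_eleven_SL₂_three
  obtain ⟨C₁, C₂, hC₁, hC₂, -, hC⟩ := exists_lattice_twentyThree_isBinaryOctahedral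
  obtain ⟨D₁, D₂, hD₁, hD₂, -, hD⟩ := exists_lattice_fiftyNine_SL₂_five
  exact ⟨exists_lattice_seven_isBinaryOctahedral, ⟨B₁, B₂, hB₁, hB₂, hB⟩,
    exists_lattice_eleven_SL₂_five, exists_lattice_nineteen_SL₂_five,
    ⟨C₁, C₂, hC₁, hC₂, hC⟩, ⟨D₁, D₂, hD₁, hD₂, hD⟩⟩
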